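/- Let f, g ∈ F(L^1(ℝ)) with g(x) ≠ 0 for all x ∈ ℝ, and suppose f(x) = 0 for all |x| > λ for some λ > 0. Then f/g ∈ F(L^1(ℝ)) (local Wiener theorem). -/

import Mathlib

open MeasureTheory

/-- The Fourier transform `(F g)(k) = ∫ e^{ikx} g(x) dx`. -/
noncomputable def FT (g : ℝ → ℂ) (k : ℝ) : ℂ :=
  ∫ x : ℝ, Complex.exp (Complex.I * k * x) * g x


open FourierTransform in
/-- `u` is the Fourier transform of an integrable function of `L¹` norm at most `M`. -/
def AMem (u : ℝ → ℂ) (M : ℝ) : Prop :=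
  ∃ k : ℝ → ℂ, Integrable k ∧ (∀ x, 𝓕 k x = u x) ∧ ∫ x, ‖k x‖ ≤ M

open FourierTransform in
lemma FT_eq (k : ℝ → ℂ) (x : ℝ) : FT k x = 𝓕 k (-x / (2 * Real.pi)) := by
  rw [FT, Real.fourier_real_eq_integral_exp_smul]
  congr 1
  ext v
  rw [smul_eq_mul]
  congr 2
  push_cast
  have : (Real.pi : ℂ) ≠ 0 := by exact_mod_cast Real.pi_ne_zero
  field_simp

open FourierTransform Convolution in
lemma AMem.mul {u v : ℝ → ℂ} {M N : ℝ} (hu : AMem u M) (hv : AMem v N) :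
    AMem (fun x => u x * v x) (M * N) := by
  obtain ⟨a, ha, hau, haM⟩ := hu
  obtain ⟨b, hb, hbv, hbN⟩ := hv
  refine ⟨a ⋆[ContinuousLinearMap.mul ℂ ℂ] b, ha.integrable_convolution _ hb, fun x => ?_, ?_⟩
  · rw [Real.fourier_mul_convolution_eq ha hb, hau, hbv]
  · have h1 : ∀ x, ‖(a ⋆[ContinuousLinearMap.mul ℂ ℂ] b) x‖ ≤
        ((fun x => ‖a x‖) ⋆[ContinuousLinearMap.mul ℝ ℝ] (fun x => ‖b x‖)) x := by
      intro x
      refine (norm_integral_le_integral_norm _).trans (le_of_eq ?_)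
      simp [convolution]
    refine (integral_mono (ha.integrable_convolution _ hb).norm
      (ha.norm.integrable_convolution _ hb.norm) h1).trans ?_
    rw [integral_convolution _ ha.norm hb.norm]
    simp only [ContinuousLinearMap.mul_apply']
    have : 0 ≤ ∫ x, ‖b x‖ := integral_nonneg fun _ => norm_nonneg _
    have h0 : 0 ≤ ∫ x, ‖a x‖ := integral_nonneg fun _ => norm_nonneg _
    gcongr
    linarith

open FourierTransform in
lemma AMem.tsum {u : ℕ → ℝ → ℂ} {M : ℕ → ℝ} (hu : ∀ n, AMem (u n) (M n)) (hM : Summable M) :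
    ∃ h : ℝ → ℂ, Integrable h ∧ ∀ x, HasSum (fun n => u n x) (𝓕 h x) := by
  choose k hk hku hkM using hu
  have hs : Summable fun n => ∫ x, ‖k n x‖ :=
    Summable.of_nonneg_of_le (fun n => integral_nonneg fun _ => norm_nonneg _) hkM hM
  have key : ∀ x, HasSum (fun n => u n x) (𝓕 (fun t => ∑' n, k n t) x) := by
    intro x
    have := hasSum_integral_of_summable_integral_norm (μ := volume)
      (F := fun n (t : ℝ) => Real.fourierChar (-(t * x)) • k n t)
      (fun n => by simpa [mul_comm] using (Real.fourierIntegral_convergent_iff (V := ℝ) x).2 (hk n)) (by simpa using hs)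
    have e1 : (fun n => u n x) =
        fun n => ∫ t : ℝ, Real.fourierChar (-(t * x)) • k n t := by
      funext n
      rw [← hku, Real.fourier_real_eq]
    have e2 : 𝓕 (fun t => ∑' n, k n t) x =
        ∫ t : ℝ, ∑' n, Real.fourierChar (-(t * x)) • k n t := by
      rw [Real.fourier_real_eq]
      congr 1
      ext t
      simp only [Circle.smul_def, smul_eq_mul]
      rw [tsum_mul_left]
    rw [e1, e2]
    exact this
  refine ⟨fun t => ∑' n, k n t, ?_, key⟩
  have hne : ∑' n, ‖(hk n).toL1 (k n)‖ₑ ≠ ⊤ := by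
    have : ∀ n, ‖(hk n).toL1 (k n)‖ₑ = ENNReal.ofReal (∫ x, ‖k n x‖) := fun n => by
      rw [ofReal_integral_norm_eq_lintegral_enorm (hk n), Integrable.enorm_toL1]
    simp_rw [this]
    exact hs.tsum_ofReal_ne_top
  have h1 := Lp.hasSum_coeFn_tsum hne
  have h2 : ∀ᵐ t, ∀ n, (hk n).toL1 (k n) t = k n t :=
    ae_all_iff.2 fun n => (hk n).coeFn_toL1
  refine (L1.integrable_coeFn (∑' n, (hk n).toL1 (k n))).congr ?_
  filter_upwards [h1, h2] with t ht1 ht2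
  rw [← ht1.tsum_eq]
  exact tsum_congr ht2

open FourierTransform in
lemma fourier_cont {u : ℝ → ℂ} (hu : Integrable u) : Continuous (𝓕 u) := by
  refine (Real.contDiff_fourier (N := 0) fun n hn => ?_).continuous
  have : n = 0 := by simpa using hn
  subst this
  simpa using hu.norm

open FourierTransform in
lemma AMem.of_contDiff {R : ℝ} (hR : 0 < R) {u : ℝ → ℂ} (hu : ContDiff ℝ 2 u) 
    (hs : ∀ x, R < |x| → u x = 0) {M : ℝ} (hM : ∀ x, ‖u x‖ ≤ M) 
    (hM2 : ∀ x, ‖deriv (deriv u) x‖ ≤ M) : AMem u (4 * R * Real.pi * M) := by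
  have hM0 : 0 ≤ M := (norm_nonneg _).trans (hM 0)
  have htsup : tsupport u ⊆ Set.Icc (-R) R := by
    apply closure_minimal _ isClosed_Icc
    intro x hx
    rw [Set.mem_Icc, ← abs_le]
    by_contra h
    exact hx (hs x (not_le.1 h))
  have hc : HasCompactSupport u := HasCompactSupport.of_support_subset_isCompact isCompact_Icc
    ((subset_tsupport _).trans htsup)
  have hu1 : ContDiff ℝ 1 (deriv u) := by
    have : ContDiff ℝ (1 + 1) u := by simpa [one_add_one_eq_two] using hu
    exact (contDiff_succ_iff_deriv.1 this).2.2
  have hu2 : Continuous (deriv (deriv u)) := hu1.continuous_deriv le_rfl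
  have iu := hu.continuous.integrable_of_hasCompactSupport hc (μ := volume)
  have iu1 := hu1.continuous.integrable_of_hasCompactSupport hc.deriv (μ := volume)
  have iu2 := hu2.integrable_of_hasCompactSupport hc.deriv.deriv (μ := volume)
  have ht2 : tsupport (deriv (deriv u)) ⊆ Set.Icc (-R) R :=
    ((tsupport_deriv_subset).trans tsupport_deriv_subset).trans htsup
  have bd : ∀ w : ℝ → ℂ, tsupport w ⊆ Set.Icc (-R) R → (∀ x, ‖w x‖ ≤ M) → ∫ x, ‖w x‖ ≤ 2 * R * M := by
    intro w hw hwM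
    rw [← setIntegral_eq_integral_of_forall_compl_eq_zero (s := Set.Icc (-R) R)]
    · have hb := norm_setIntegral_le_of_norm_le_const (μ := volume) (s := Set.Icc (-R) R)
        (f := fun x => ‖w x‖) (C := M) measure_Icc_lt_top
        (fun x _ => by rw [norm_norm]; exact hwM x)
      refine (le_abs_self _).trans (hb.trans ?_)
      simp [Measure.real, show 0 ≤ R + R by linarith]
      nlinarith
    · intro x hx
      rw [image_eq_zero_of_notMem_tsupport (fun h => hx (hw h)), norm_zero]
  have b0 := bd u htsup hM
  have b2 := bd _ ht2 hM2
  have hF : ∀ x, 𝓕 (deriv (deriv u)) x = (2 * Real.pi * Complex.I * x) * ((2 * Real.pi * Complex.I * x) * 𝓕 u x) := by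
    intro x
    rw [Real.fourier_deriv iu1 (hu1.differentiable (by norm_num)) iu2, Real.fourier_deriv iu (hu.differentiable (by norm_num)) iu1]
    simp
  have le1 : ∀ (w : ℝ → ℂ) (x : ℝ), ‖𝓕 w x‖ ≤ ∫ x, ‖w x‖ := by
    intro w x
    rw [Real.fourier_real_eq]
    refine (norm_integral_le_integral_norm _).trans (le_of_eq ?_)
    simp
  have hb : ∀ x, ‖𝓕 u x‖ ≤ 4 * R * M * (1 + x ^ 2)⁻¹ := by
    intro x
    rw [← div_eq_mul_inv, le_div_iff₀ (by positivity)]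
    have h1 := (le1 u x).trans b0
    have h2 := (le1 _ x).trans b2
    rw [hF] at h2
    simp only [norm_mul, Complex.norm_I, Complex.norm_real, Complex.norm_ofNat, Real.norm_eq_abs, abs_of_pos Real.pi_pos] at h2
    have h3 : (2 * Real.pi * 1 * |x| * (2 * Real.pi * 1 * |x| * ‖𝓕 u x‖)) = (2 * Real.pi)^2 * (x^2 * ‖𝓕 u x‖) := by
      rw [← sq_abs x]; ring
    rw [h3] at h2
    have h4 : 1 ≤ (2 * Real.pi)^2 := by nlinarith [Real.pi_gt_three]
    have h5 : 0 ≤ x^2 * ‖𝓕 u x‖ := by positivity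
    nlinarith
  have icauchy := (integrable_inv_one_add_sq).const_mul (4 * R * M)
  have iFu : Integrable (𝓕 u) := 
    icauchy.mono' (fourier_cont iu).aestronglyMeasurable (Filter.Eventually.of_forall hb)
  have hinv : 𝓕⁻ u = fun x => 𝓕 u (-x) := by
    ext x; rw [Real.fourierInv_eq_fourier_neg]
  refine ⟨𝓕⁻ u, ?_, fun x => ?_, ?_⟩
  · rw [hinv]; exact iFu.comp_neg
  · rw [Continuous.fourier_fourierInv_eq hu.continuous iu iFu]
  · rw [hinv]
    rw [integral_neg_eq_self (fun x => ‖𝓕 u x‖)]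
    refine (integral_mono iFu.norm icauchy hb).trans (le_of_eq ?_)
    rw [integral_const_mul, integral_univ_inv_one_add_sq]
    ring

open FourierTransform in
/-- Powers of a smooth compactly supported function: `L¹`-norm growth of the inverse transform. -/
lemma AMem.pow {R : ℝ} (hR : 0 < R) {Q : ℝ → ℂ} (hQ : ContDiff ℝ 2 Q)
    (hs : ∀ x, R < |x| → Q x = 0) {q : ℝ} (hq0 : 0 < q) (hq : ∀ x, ‖Q x‖ ≤ q) :
    ∃ C : ℝ, ∀ n : ℕ, AMem (fun x => Q x ^ (n + 1)) (C * ((n + 1) ^ 2 * q ^ n)) := by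
  have hc : HasCompactSupport Q := by
    refine HasCompactSupport.of_support_subset_isCompact (K := Set.Icc (-R) R) isCompact_Icc ?_
    intro x hx
    rw [Set.mem_Icc, ← abs_le]
    by_contra h
    exact hx (hs x (not_le.1 h))
  have hQ1 : ContDiff ℝ 1 (deriv Q) := by
    have : ContDiff ℝ (1 + 1) Q := by simpa [one_add_one_eq_two] using hQ
    exact (contDiff_succ_iff_deriv.1 this).2.2
  have hQ2 : Continuous (deriv (deriv Q)) := hQ1.continuous_deriv le_rfl
  obtain ⟨B1, hB1⟩ := hQ1.continuous.bounded_above_of_compact_support hc.deriv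
  obtain ⟨B2, hB2⟩ := hQ2.bounded_above_of_compact_support hc.deriv.deriv
  have hB10 : 0 ≤ B1 := (norm_nonneg _).trans (hB1 0)
  have hB20 : 0 ≤ B2 := (norm_nonneg _).trans (hB2 0)
  have hd : ∀ x, HasDerivAt Q (deriv Q x) x := fun x =>
    (hQ.differentiable (by norm_num) x).hasDerivAt
  have hd1 : ∀ x, HasDerivAt (deriv Q) (deriv (deriv Q) x) x := fun x =>
    (hQ1.differentiable (by norm_num) x).hasDerivAt
  refine ⟨4 * R * Real.pi * (q + B1 ^ 2 / q + B2), fun n => ?_⟩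
  have e1 : deriv (fun x => Q x ^ (n + 1)) = fun x => ((n + 1 : ℕ) : ℂ) * Q x ^ n * deriv Q x := by
    funext x
    exact ((hd x).pow (n + 1)).deriv
  have e2 : ∀ x, deriv (deriv (fun x => Q x ^ (n + 1))) x =
      ((n + 1 : ℕ) : ℂ) * ((n : ℂ) * Q x ^ (n - 1) * deriv Q x) * deriv Q x
        + ((n + 1 : ℕ) : ℂ) * Q x ^ n * deriv (deriv Q) x := by
    intro x
    rw [e1]
    exact ((((hd x).pow n).const_mul ((n + 1 : ℕ) : ℂ)).mul (hd1 x)).deriv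
  have hqn : 0 < q ^ n := pow_pos hq0 n
  have hn1 : (1 : ℝ) ≤ (n + 1) ^ 2 := by nlinarith [(Nat.cast_nonneg n : (0 : ℝ) ≤ n)]
  have := AMem.of_contDiff hR (u := fun x => Q x ^ (n + 1)) (hQ.pow _)
    (fun x hx => by simp [hs x hx]) (M := (q + B1 ^ 2 / q + B2) * ((n + 1) ^ 2 * q ^ n)) ?_ ?_
  · convert this using 1
    ring
  · intro x
    rw [norm_pow]
    calc ‖Q x‖ ^ (n + 1) ≤ q ^ (n + 1) := by gcongr; exact hq x
      _ = q * (1 * q ^ n) := by ring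
      _ ≤ (q + B1 ^ 2 / q + B2) * ((n + 1) ^ 2 * q ^ n) := by
        gcongr
        have : 0 ≤ B1 ^ 2 / q := by positivity
        linarith
  · intro x
    rw [e2]
    have t1 : ‖((n + 1 : ℕ) : ℂ) * ((n : ℂ) * Q x ^ (n - 1) * deriv Q x) * deriv Q x‖ ≤
        (B1 ^ 2 / q) * ((n + 1) ^ 2 * q ^ n) := by
      rcases n with _ | m
      · simp; positivity
      · simp only [norm_mul, norm_pow, Complex.norm_natCast, Nat.add_sub_cancel]
        calc ((m + 1 + 1 : ℕ) : ℝ) * (((m + 1 : ℕ) : ℝ) * ‖Q x‖ ^ m * ‖deriv Q x‖) * ‖deriv Q x‖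
            ≤ ((m + 1 + 1 : ℕ) : ℝ) * (((m + 1 + 1 : ℕ) : ℝ) * q ^ m * B1) * B1 := by
              have := hq x
              have := hB1 x
              gcongr
              omega
          _ = _ := by push_cast; field_simp; ring
    have t2 : ‖((n + 1 : ℕ) : ℂ) * Q x ^ n * deriv (deriv Q) x‖ ≤
        B2 * ((n + 1) ^ 2 * q ^ n) := by
      simp only [norm_mul, norm_pow, Complex.norm_natCast]
      calc ((n + 1 : ℕ) : ℝ) * ‖Q x‖ ^ n * ‖deriv (deriv Q) x‖
          ≤ ((n + 1 : ℕ) : ℝ) * q ^ n * B2 := by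
            have := hq x
            have := hB2 x
            gcongr
        _ = B2 * ((n + 1) * q ^ n) := by push_cast; ring
        _ ≤ _ := by
          gcongr
          nlinarith [(Nat.cast_nonneg n : (0 : ℝ) ≤ n)]
    refine (norm_add_le _ _).trans ((add_le_add t1 t2).trans ?_)
    have : 0 ≤ q * ((n + 1) ^ 2 * q ^ n) := by positivity
    linarith

open FourierTransform in
lemma wiener_aux (f₁ g₁ : ℝ → ℂ) (hf : Integrable f₁) (hg : Integrable g₁)
    (hg0 : ∀ x, 𝓕 g₁ x ≠ 0) (lam : ℝ) (hlam : 0 < lam) (hsupp : ∀ x, lam < |x| → 𝓕 f₁ x = 0) :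
    ∃ h : ℝ → ℂ, Integrable h ∧ ∀ x, 𝓕 f₁ x / 𝓕 g₁ x = 𝓕 h x := by
  have le1 : ∀ (w : ℝ → ℂ) (x : ℝ), ‖𝓕 w x‖ ≤ ∫ x, ‖w x‖ := by
    intro w x
    rw [Real.fourier_real_eq]
    refine (norm_integral_le_integral_norm _).trans (le_of_eq ?_)
    simp
  obtain ⟨x₀, -, hx₀⟩ := (isCompact_Icc (a := -(lam + 1)) (b := lam + 1)).exists_isMinOn
    ⟨0, by constructor <;> linarith⟩ (fourier_cont hg).norm.continuousOn
  set ε : ℝ := ‖𝓕 g₁ x₀‖ / 3 with hε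
  have hε0 : 0 < ε := by
    have := norm_pos_iff.2 (hg0 x₀)
    positivity
  have hGlow : ∀ x, |x| ≤ lam + 1 → 3 * ε ≤ ‖𝓕 g₁ x‖ := by
    intro x hx
    have := hx₀ (abs_le.1 hx)
    simp only [Set.mem_ofPred_eq] at this
    rw [hε]; linarith
  obtain ⟨p, hpc, hpε, hpcont, hpi⟩ := hg.exists_hasCompactSupport_integral_sub_le hε0
  -- the difference
  have hdi : Integrable (fun x => p x - g₁ x) := hpi.sub hg
  have hD : ∀ x, 𝓕 (fun x => p x - g₁ x) x = 𝓕 p x - 𝓕 g₁ x := by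
    intro x
    simp only [Real.fourier_real_eq, smul_sub]
    refine integral_sub ?_ ?_
    · simpa [mul_comm] using (Real.fourierIntegral_convergent_iff (V := ℝ) x).2 hpi
    · simpa [mul_comm] using (Real.fourierIntegral_convergent_iff (V := ℝ) x).2 hg
  have hdε : ∫ x, ‖p x - g₁ x‖ ≤ ε := by
    simpa only [norm_sub_rev] using hpε
  have hDle : ∀ x, ‖𝓕 p x - 𝓕 g₁ x‖ ≤ ε := fun x => by
    rw [← hD]; exact (le1 _ x).trans hdε
  have hPlow : ∀ x, |x| ≤ lam + 1 → 2 * ε ≤ ‖𝓕 p x‖ := by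
    intro x hx
    have h1 := hGlow x hx
    have h2 := hDle x
    have h3 : ‖𝓕 g₁ x‖ ≤ ‖𝓕 p x‖ + ‖𝓕 p x - 𝓕 g₁ x‖ := norm_le_insert _ _
    linarith
  have hPsm : ContDiff ℝ 2 (𝓕 p) := by
    refine Real.contDiff_fourier (N := 2) fun n _ => ?_
    refine Continuous.integrable_of_hasCompactSupport (by fun_prop) ?_
    exact hpc.norm.mul_left
  let χ : ContDiffBump (0 : ℝ) := ⟨lam, lam + 1, hlam, by linarith⟩
  have hχout : ∀ x, lam + 1 < |x| → χ x = 0 := fun x hx =>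
    χ.zero_of_le_dist (by simpa using hx.le)
  have hχin : ∀ x, |x| ≤ lam → χ x = 1 := fun x hx =>
    χ.one_of_mem_closedBall (by simpa using hx)
  let Q : ℝ → ℂ := fun x => (χ x : ℂ) / 𝓕 p x
  have hQ : ContDiff ℝ 2 Q := by
    rw [contDiff_iff_contDiffAt]
    intro x
    by_cases hx : |x| ≤ lam + 1
    · have hP : 𝓕 p x ≠ 0 := by
        have := hPlow x hx
        rw [← norm_pos_iff]; linarith
      simp only [Q, div_eq_mul_inv]
      refine ContDiffAt.mul ?_ (hPsm.contDiffAt.inv hP)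
      exact Complex.ofRealCLM.contDiff.contDiffAt.comp x χ.contDiffAt
    · have : Q =ᶠ[nhds x] fun _ => 0 := by
        have ho : IsOpen {y : ℝ | lam + 1 < |y|} := isOpen_lt continuous_const continuous_abs
        filter_upwards [ho.mem_nhds (not_le.1 hx)] with y hy
        simp [Q, hχout y hy]
      exact contDiffAt_const.congr_of_eventuallyEq this
  have hq0 : 0 < (2 * ε)⁻¹ := by positivity
  have hQq : ∀ x, ‖Q x‖ ≤ (2 * ε)⁻¹ := by
    intro x
    by_cases hx : |x| ≤ lam + 1
    · simp only [Q, norm_div, Complex.norm_real, Real.norm_eq_abs, abs_of_nonneg χ.nonneg]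
      rw [inv_eq_one_div]
      have := hPlow x hx
      gcongr
      exact χ.le_one
    · simp only [Q, hχout x (not_le.1 hx)]
      simpa using hε0.le
  obtain ⟨C, hC⟩ := AMem.pow (R := lam + 1) (by linarith) hQ
    (fun x hx => by simp [Q, hχout x hx]) hq0 hQq
  have hFD : ∀ n : ℕ, AMem (fun x => 𝓕 f₁ x * (𝓕 p x - 𝓕 g₁ x) ^ n)
      ((∫ x, ‖f₁ x‖) * ε ^ n) := by
    intro n
    induction n with
    | zero => exact ⟨f₁, hf, fun x => by simp, by simp⟩
    | succ n ih =>
      have := ih.mul (⟨_, hdi, hD, hdε⟩ : AMem (fun x => 𝓕 p x - 𝓕 g₁ x) ε)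
      simpa only [pow_succ, mul_assoc] using this
  obtain ⟨h, hh, hsum⟩ := AMem.tsum (fun n => (hFD n).mul (hC n)) (by
    have hs : Summable fun n : ℕ => ((n : ℝ) + 1) ^ 2 * (1 / 2 : ℝ) ^ n := by
      have s2 := summable_pow_mul_geometric_of_norm_lt_one 2 (r := (1 / 2 : ℝ)) (by norm_num)
      have s1 := summable_pow_mul_geometric_of_norm_lt_one 1 (r := (1 / 2 : ℝ)) (by norm_num)
      have s0 := summable_pow_mul_geometric_of_norm_lt_one 0 (r := (1 / 2 : ℝ)) (by norm_num)
      refine ((s2.add (s1.mul_left 2)).add s0).congr fun n => ?_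
      ring
    refine (hs.mul_left ((∫ x, ‖f₁ x‖) * C)).congr fun n => ?_
    have : (1 / 2 : ℝ) ^ n = ε ^ n * ((2 * ε)⁻¹) ^ n := by
      rw [← mul_pow]; congr 1; field_simp
    rw [this]; ring)
  refine ⟨h, hh, fun x => (HasSum.unique ?_ (hsum x))⟩
  by_cases hx : |x| ≤ lam
  · have hPl := hPlow x (by linarith)
    have hP : 𝓕 p x ≠ 0 := by
      rw [← norm_pos_iff]; linarith
    have hQx : Q x = (𝓕 p x)⁻¹ := by simp [Q, hχin x hx]
    have hr : ‖(𝓕 p x - 𝓕 g₁ x) / 𝓕 p x‖ < 1 := by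
      rw [norm_div, div_lt_one (by linarith)]
      linarith [hDle x]
    have := (hasSum_geometric_of_norm_lt_one hr).mul_left (𝓕 f₁ x / 𝓕 p x)
    have e1 : (fun n => 𝓕 f₁ x * (𝓕 p x - 𝓕 g₁ x) ^ n * Q x ^ (n + 1)) =
        fun n => 𝓕 f₁ x / 𝓕 p x * ((𝓕 p x - 𝓕 g₁ x) / 𝓕 p x) ^ n := by
      funext n
      rw [hQx, div_pow, pow_succ, inv_pow]
      field_simp
    have e2 : 𝓕 f₁ x / 𝓕 g₁ x =
        𝓕 f₁ x / 𝓕 p x * (1 - (𝓕 p x - 𝓕 g₁ x) / 𝓕 p x)⁻¹ := by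
      have := hg0 x
      have e : 1 - (𝓕 p x - 𝓕 g₁ x) / 𝓕 p x = 𝓕 g₁ x / 𝓕 p x := by
        field_simp; ring
      rw [e]
      field_simp
    rw [e2]
    exact e1 ▸ this
  · simp [hsupp x (not_le.1 hx), hasSum_zero]

theorem local_wiener (f g : ℝ → ℂ)
    (hf : ∃ f₁ : ℝ → ℂ, Integrable f₁ ∧ ∀ x, f x = FT f₁ x)
    (hg : ∃ g₁ : ℝ → ℂ, Integrable g₁ ∧ ∀ x, g x = FT g₁ x)
    (hg0 : ∀ x : ℝ, g x ≠ 0) (lam : ℝ) (hlam : 0 < lam)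
    (hfsupp : ∀ x : ℝ, lam < |x| → f x = 0) :
    ∃ h : ℝ → ℂ, Integrable h ∧ ∀ x : ℝ, f x / g x = FT h x := by
  obtain ⟨f₁, hf₁, hf⟩ := hf
  obtain ⟨g₁, hg₁, hg⟩ := hg
  have key : ∀ (k : ℝ → ℂ) (y : ℝ), FourierTransform.fourier k y = FT k (-(2 * Real.pi * y)) := by
    intro k y
    rw [FT_eq]
    congr 1
    have := Real.pi_ne_zero
    field_simp
  obtain ⟨h, hh, hx⟩ := wiener_aux f₁ g₁ hf₁ hg₁ (fun x => by rw [key, ← hg]; exact hg0 _) lam hlam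
    (fun x hx => by
      rw [key, ← hf]
      apply hfsupp
      rw [abs_neg, abs_mul, abs_of_pos (by positivity)]
      nlinarith [Real.pi_gt_three, abs_nonneg x])
  refine ⟨h, hh, fun x => ?_⟩
  rw [hf, hg, FT_eq, FT_eq, FT_eq, hx]
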